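/- Let r, s be coprime Gaussian integers. If r ≡ 1 and s ≡ 0 modulo 1+i, then there exist p, q ∈ ℤ[i] with p·s − q·r = 1, p ≡ 1 and q ≡ 1 modulo 1+i. If instead r ≡ 1 and s ≡ 1 modulo 1+i, then there exist p, q ∈ ℤ[i] with p·s − q·r = 1, p ≡ 1 and q ≡ 0 modulo 1+i. (In either case the row (r s) extends to a matrix of SL(2,ℤ[i]) with prescribed residues modulo 1+i.) -/

import Mathlib

open Complex

noncomputable section

/-- `z ∈ ℤ[i] ⊆ ℂ`. -/
def IsGauss (z : ℂ) : Prop := ∃ a b : ℤ, z = (a : ℂ) + (b : ℂ) * Complex.I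

/-- Divisibility in `ℤ[i]`. -/
def GDvd (m z : ℂ) : Prop := ∃ k : ℂ, IsGauss k ∧ z = m * k

/-- Congruence modulo `m` in `ℤ[i]`. -/
def GCong (m z w : ℂ) : Prop := GDvd m (z - w)

/-- Coprimality in `ℤ[i]` (Bézout). -/
def GCoprime (r s : ℂ) : Prop :=
  ∃ p q : ℂ, IsGauss p ∧ IsGauss q ∧ p * r + q * s = 1

lemma IsGauss.add {z w : ℂ} (hz : IsGauss z) (hw : IsGauss w) : IsGauss (z + w) := by
  obtain ⟨a, b, rfl⟩ := hz
  obtain ⟨c, d, rfl⟩ := hw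
  exact ⟨a + c, b + d, by push_cast; ring⟩

lemma IsGauss.neg {z : ℂ} (hz : IsGauss z) : IsGauss (-z) := by
  obtain ⟨a, b, rfl⟩ := hz
  exact ⟨-a, -b, by push_cast; ring⟩

lemma IsGauss.mul {z w : ℂ} (hz : IsGauss z) (hw : IsGauss w) : IsGauss (z * w) := by
  obtain ⟨a, b, rfl⟩ := hz
  obtain ⟨c, d, rfl⟩ := hw
  refine ⟨a * c - b * d, a * d + b * c, ?_⟩
  push_cast
  linear_combination (b * d : ℂ) * Complex.I_sq

lemma GDvd.add {m z w : ℂ} (hz : GDvd m z) (hw : GDvd m w) : GDvd m (z + w) := by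
  obtain ⟨k, hk, rfl⟩ := hz
  obtain ⟨l, hl, rfl⟩ := hw
  exact ⟨k + l, hk.add hl, by ring⟩

lemma GDvd.mul_left {m z c : ℂ} (hc : IsGauss c) (hz : GDvd m z) : GDvd m (c * z) := by
  obtain ⟨k, hk, rfl⟩ := hz
  exact ⟨c * k, hc.mul hk, by ring⟩

lemma gDvd_one_add_I_neg_two : GDvd (1 + Complex.I) (-2) :=
  ⟨-1 + Complex.I, ⟨-1, 1, by push_cast; ring⟩, by linear_combination -Complex.I_sq⟩

/-- The residue field of `ℤ[i]` at `1 + i` has two elements. -/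
lemma IsGauss.gCong_zero_or_one {z : ℂ} (hz : IsGauss z) :
    GCong (1 + Complex.I) z 0 ∨ GCong (1 + Complex.I) z 1 := by
  obtain ⟨a, b, rfl⟩ := hz
  rcases Int.even_or_odd' (a + b) with ⟨k, h | h⟩
  · left
    obtain rfl : a = 2 * k - b := by omega
    refine ⟨k + (b - k : ℤ) * Complex.I, ⟨k, b - k, rfl⟩, ?_⟩
    push_cast
    linear_combination (k - b : ℂ) * Complex.I_sq
  · right
    obtain rfl : a = 2 * k + 1 - b := by omega
    refine ⟨k + (b - k : ℤ) * Complex.I, ⟨k, b - k, rfl⟩, ?_⟩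
    push_cast
    linear_combination (k - b : ℂ) * Complex.I_sq

/-- If `r ≡ 1 (mod 1+i)`, the first entry of a completion of `(r s)` can be taken `≡ 1`. -/
lemma GCoprime.exists_completion {r s : ℂ} (hr : IsGauss r) (hs : IsGauss s)
    (hcop : GCoprime r s) (hr1 : GCong (1 + Complex.I) r 1) :
    ∃ p q : ℂ, IsGauss p ∧ IsGauss q ∧ p * s - q * r = 1 ∧ GCong (1 + Complex.I) p 1 := by
  obtain ⟨u, p, hu, hp, h⟩ := hcop
  rcases hp.gCong_zero_or_one with hp0 | hp1
  · refine ⟨p + r, -u + s, hp.add hr, hu.neg.add hs, by linear_combination h, ?_⟩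
    have := GDvd.add hp0 hr1
    rwa [show p - 0 + (r - 1) = p + r - 1 by ring] at this
  · exact ⟨p, -u, hp, hu.neg, by linear_combination h, hp1⟩

/-- Completion of a coprime row `(r s)` to an element of `SL(2,ℤ[i])` with prescribed
residues modulo `1+i`: if `r ≡ 1, s ≡ 0 (mod 1+i)` there are `p, q ∈ ℤ[i]` with
`p·s − q·r = 1`, `p ≡ 1, q ≡ 1`; if `r ≡ 1, s ≡ 1 (mod 1+i)` there are `p, q ∈ ℤ[i]`
with `p·s − q·r = 1`, `p ≡ 1, q ≡ 0`. -/
theorem stmt9 (r s : ℂ) (hr : IsGauss r) (hs : IsGauss s) (hcop : GCoprime r s) :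
    ((GCong (1 + Complex.I) r 1 ∧ GCong (1 + Complex.I) s 0) →
      ∃ p q : ℂ, IsGauss p ∧ IsGauss q ∧ p * s - q * r = 1 ∧
        GCong (1 + Complex.I) p 1 ∧ GCong (1 + Complex.I) q 1) ∧
    ((GCong (1 + Complex.I) r 1 ∧ GCong (1 + Complex.I) s 1) →
      ∃ p q : ℂ, IsGauss p ∧ IsGauss q ∧ p * s - q * r = 1 ∧
        GCong (1 + Complex.I) p 1 ∧ GCong (1 + Complex.I) q 0) := by
  refine ⟨fun ⟨hr1, hs0⟩ => ?_, fun ⟨hr1, hs1⟩ => ?_⟩ <;>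
    obtain ⟨p, q, hp, hq, h, hp1⟩ := hcop.exists_completion hr hs hr1 <;>
    refine ⟨p, q, hp, hq, h, hp1, ?_⟩
  · have := ((GDvd.mul_left hq.neg hr1).add (GDvd.mul_left hp hs0)).add gDvd_one_add_I_neg_two
    rwa [show -q * (r - 1) + p * (s - 0) + -2 = q - 1 by linear_combination h] at this
  · have := ((GDvd.mul_left hq.neg hr1).add (GDvd.mul_left hp hs1)).add hp1
    rwa [show -q * (r - 1) + p * (s - 1) + (p - 1) = q - 0 by linear_combination h] at this
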